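/- There is no finite group of order 3520 (= 55·64 = 2⁶·5·11) that has an irreducible complex character of degree 55. -/

import Mathlib

open CategoryTheory

/-- `χ : G → ℂ` is the character of an irreducible (simple) finite-dimensional complex
representation of the group `G`. -/
def IsIrrChar (G : Type) [Group G] (χ : G → ℂ) : Prop :=
  ∃ V : FDRep ℂ G, Simple V ∧ FDRep.character V = χ

/-- An element of order coprime to `q - 1` that normalizes a subgroup of prime order `q`
centralizes it. -/
theorem mem_centralizer_of_mem_normalizer_of_coprime {G : Type*} [Group G] {q : ℕ} [Fact q.Prime]
    {Q : Subgroup G} (hQ : Nat.card Q = q) {y : G} (hy : y ∈ Subgroup.normalizer (Q : Set G))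
    (hcop : (orderOf y).Coprime (q - 1)) : y ∈ Subgroup.centralizer (Q : Set G) := by
  have : Finite Q := Nat.finite_of_card_ne_zero (hQ ▸ (Fact.out : q.Prime).ne_zero)
  have : IsCyclic Q := isCyclic_of_prime_card hQ
  have hcard : Nat.card (MulAut Q) = q - 1 := by
    rw [IsCyclic.card_mulAut, hQ, Nat.totient_prime Fact.out]
  have h1 : orderOf (Q.normalizerMonoidHom ⟨y, hy⟩) ∣ orderOf y := by
    rw [← Subgroup.orderOf_mk y hy]
    exact orderOf_map_dvd _ _
  have h2 : orderOf (Q.normalizerMonoidHom ⟨y, hy⟩) ∣ q - 1 := hcard ▸ orderOf_dvd_natCard _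
  have h3 : (⟨y, hy⟩ : Subgroup.normalizer (Q : Set G)) ∈ Q.normalizerMonoidHom.ker :=
    MonoidHom.mem_ker.mpr (orderOf_eq_one_iff.mp (Nat.eq_one_of_dvd_coprimes hcop h1 h2))
  rw [Subgroup.normalizerMonoidHom_ker] at h3
  exact Subgroup.mem_subgroupOf.mp h3

/-- A Sylow `11`-subgroup of a group of order `3520` is normal, and has order `11`. -/
theorem Sylow.normal_of_card_eq_3520 {G : Type*} [Group G] [Finite G] (hcard : Nat.card G = 3520)
    (P : Sylow 11 G) : P.Normal ∧ Nat.card P = 11 := by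
  have : Fact (Nat.Prime 11) := ⟨by norm_num⟩
  have : Fact (Nat.Prime 5) := ⟨by norm_num⟩
  have card_sylow (R : Sylow 11 G) : Nat.card R = 11 := by
    rw [R.card_eq_multiplicity, hcard, Nat.factorization_def _ Fact.out,
      show (3520 : ℕ) = 320 * 11 ^ 1 by norm_num, padicValNat.mul (by norm_num) (by norm_num),
      padicValNat.prime_pow, padicValNat.eq_zero_of_not_dvd (by norm_num)]
    rfl
  refine ⟨?_, card_sylow P⟩
  have index_sylow : P.index = 320 := by
    have := P.card_mul_index
    rw [card_sylow, hcard] at this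
    omega
  have hdvd : Nat.card (Sylow 11 G) ∣ 320 := index_sylow ▸ P.card_dvd_index
  have hmod : Nat.card (Sylow 11 G) ≡ 1 [MOD 11] := card_sylow_modEq_one 11 G
  have hn : Nat.card (Sylow 11 G) = 1 ∨ Nat.card (Sylow 11 G) = 320 := by
    have key : ∀ n ∈ Nat.divisors 320, n % 11 = 1 → n = 1 ∨ n = 320 := by decide +kernel
    exact key _ (Nat.mem_divisors.mpr ⟨hdvd, by norm_num⟩) hmod
  obtain hn | hn := hn
  · have := (Nat.card_eq_one_iff_unique.mp hn).1
    exact P.normal_of_subsingleton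
  exfalso
  have card_normalizer (R : Sylow 11 G) : Nat.card (Subgroup.normalizer (R : Set G)) = 11 := by
    have := (Subgroup.normalizer (R : Set G)).card_mul_index
    rw [← R.card_eq_index_normalizer, hn, hcard] at this
    omega
  have hPC : Subgroup.normalizer (P : Set G) ≤ Subgroup.centralizer (P : Set G) := by
    have : IsCyclic P := isCyclic_of_prime_card (card_sylow P)
    have hle : (P : Subgroup G) ≤ Subgroup.centralizer (P : Set G) :=
      Subgroup.le_centralizer (P : Subgroup G)
    exact (Subgroup.eq_of_le_of_card_ge Subgroup.le_normalizer
      ((card_normalizer P).trans (card_sylow P).symm).le).ge.trans hle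
  set K := (MonoidHom.transferSylow P hPC).ker
  have hcompl : Subgroup.IsComplement' K P := MonoidHom.ker_transferSylow_isComplement' P hPC
  have hKindex : K.index = 11 := hcompl.symm.index_eq_card.trans (card_sylow P)
  have hKcard : Nat.card K = 320 := hcompl.index_eq_card.symm.trans index_sylow
  obtain ⟨Q⟩ : Nonempty (Sylow 5 K) := inferInstance
  have hQ : Nat.card (Q.map K.subtype) = 5 := by
    rw [Subgroup.card_map_of_injective K.subtype_injective, Q.card_eq_multiplicity, hKcard,
      Nat.factorization_def _ Fact.out,
      show (320 : ℕ) = 64 * 5 ^ 1 by norm_num, padicValNat.mul (by norm_num) (by norm_num),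
      padicValNat.prime_pow, padicValNat.eq_zero_of_not_dvd (by norm_num)]
    rfl
  have hdvd : 11 ∣ Nat.card (Subgroup.normalizer (Q.map K.subtype : Set G)) := by
    have := Subgroup.relIndex_dvd_card K (Subgroup.normalizer (Q.map K.subtype : Set G))
    rwa [← Subgroup.relIndex_sup_right, Q.normalizer_sup_eq_top, Subgroup.relIndex_top_right,
      hKindex] at this
  obtain ⟨⟨y, hy⟩, hyord⟩ := exists_prime_orderOf_dvd_card' 11 hdvd
  rw [Subgroup.orderOf_mk] at hyord
  have hyC := mem_centralizer_of_mem_normalizer_of_coprime hQ hy (by rw [hyord]; norm_num)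
  have hycard : Nat.card (Subgroup.zpowers y) = 11 := by rw [Nat.card_zpowers, hyord]
  obtain ⟨R, hR⟩ := (IsPGroup.of_card (p := 11) (n := 1) hycard).exists_le_sylow
  have hyR : Subgroup.zpowers y = R :=
    Subgroup.eq_of_le_of_card_ge hR ((card_sylow R).trans hycard.symm).le
  have hQR : Q.map K.subtype ≤ Subgroup.normalizer (R : Set G) := by
    refine le_trans ?_ (Subgroup.centralizer_le_normalizer _)
    have hRQ : (R : Subgroup G) ≤ Subgroup.centralizer (Q.map K.subtype : Subgroup G) := by
      rwa [← hyR, Subgroup.zpowers_le]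
    exact Subgroup.le_centralizer_iff.mp hRQ
  have := Subgroup.card_dvd_of_le hQR
  rw [hQ, card_normalizer] at this
  omega

theorem Submodule.finrank_biSup_le {ι k V : Type*} [DivisionRing k] [AddCommGroup V] [Module k V]
    [FiniteDimensional k V] (s : Finset ι) (U : ι → Submodule k V) :
    Module.finrank k (⨆ i ∈ s, U i : Submodule k V) ≤ ∑ i ∈ s, Module.finrank k (U i) := by
  classical
  induction s using Finset.induction_on with
  | empty => simp
  | insert a s ha ih =>
    rw [Finset.iSup_insert, Finset.sum_insert ha]
    exact (Submodule.finrank_add_le_finrank_add_finrank _ _).trans (by gcongr)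

namespace Representation

variable {k G V : Type*} [Field k] [Group G] [AddCommGroup V] [Module k V]

/-- Burnside's theorem: an irreducible representation over an algebraically closed field maps the
group algebra onto the full endomorphism algebra. -/
theorem asAlgebraHom_surjective_of_isIrreducible [IsAlgClosed k] [FiniteDimensional k V]
    (ρ : Representation k G V) [ρ.IsIrreducible] : Function.Surjective ρ.asAlgebraHom := by
  intro f
  have hf (φ : Module.End (MonoidAlgebra k G) ρ.asModule) (v : ρ.asModule) :
      f (φ v) = φ (f v) := by
    obtain ⟨c, rfl⟩ := (IsSimpleModule.algebraMap_end_bijective_of_isAlgClosed k).2 φ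
    exact f.map_smul c v
  let F : Module.End (Module.End (MonoidAlgebra k G) ρ.asModule) ρ.asModule :=
    { toFun := f, map_add' := f.map_add, map_smul' := hf }
  classical
  let b := Module.finBasis k ρ.asModule
  obtain ⟨a, ha⟩ := jacobson_density F (Finset.univ.image b)
  exact ⟨a, b.ext fun i => (ha (b i) (Finset.mem_image_of_mem _ (Finset.mem_univ i))).symm⟩

/-- If a subgroup `H` acts on a subspace `U` of an irreducible representation by scalars, then
`dim V * dim U ≤ [G : H]`, a form of Frobenius reciprocity. -/
theorem finrank_mul_finrank_le_index [IsAlgClosed k] [FiniteDimensional k V]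
    (ρ : Representation k G V) [ρ.IsIrreducible] (H : Subgroup G) [H.FiniteIndex]
    (U : Submodule k V) (hU : ∀ h ∈ H, ∃ c : k, ∀ u ∈ U, ρ h u = c • u) :
    Module.finrank k U * Module.finrank k V ≤ H.index := by
  have := H.fintypeQuotientOfFiniteIndex
  have hspan : Submodule.span k (Set.range fun q : G ⧸ H => (ρ q.out).domRestrict U) = ⊤ := by
    refine eq_top_iff.mpr fun f _ => ?_
    obtain ⟨f', rfl⟩ := f.exists_extend
    obtain ⟨a, rfl⟩ := ρ.asAlgebraHom_surjective_of_isIrreducible f'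
    induction a using MonoidAlgebra.induction_linear with
    | zero => simp
    | add a b ha hb =>
      rw [map_add, LinearMap.add_comp]
      exact add_mem (ha Submodule.mem_top) (hb Submodule.mem_top)
    | single g r =>
      obtain ⟨h, hh⟩ := QuotientGroup.mk_out_eq_mul H g
      obtain ⟨c, hc⟩ := hU (h : G)⁻¹ (inv_mem h.2)
      have : (ρ.asAlgebraHom (MonoidAlgebra.single g r)) ∘ₗ U.subtype =
          (r * c) • (ρ (g : G ⧸ H).out).domRestrict U := by
        ext u
        have hg : g = (g : G ⧸ H).out * (h : G)⁻¹ := by rw [hh]; group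
        conv_lhs => rw [hg]
        simp [hc u u.2, mul_smul]
      rw [this]
      exact Submodule.smul_mem _ _ (Submodule.subset_span ⟨_, rfl⟩)
  have hle := finrank_range_le_card (R := k) fun q : G ⧸ H => (ρ q.out).domRestrict U
  rwa [Set.finrank, hspan, finrank_top, Module.finrank_linearMap, ← Nat.card_eq_fintype_card,
    ← Subgroup.index] at hle

/-- If a normal subgroup `P` of prime order `p` acts nontrivially in an irreducible representation
of degree `d`, which is forced by `[G : P] < d ^ 2`, then it acts through at most `p - 1`
characters, each of multiplicity at most `[G : P] / d`. -/
theorem finrank_le_of_normal_of_card_prime [IsAlgClosed k] [CharZero k] [FiniteDimensional k V]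
    (ρ : Representation k G V) [ρ.IsIrreducible] (P : Subgroup G) [P.Normal] [P.FiniteIndex]
    {p : ℕ} [hp : Fact p.Prime] (hP : Nat.card P = p)
    (hV : P.index < Module.finrank k V ^ 2) :
    Module.finrank k V ≤ (p - 1) * (P.index / Module.finrank k V) := by
  classical
  have : Finite P := Nat.finite_of_card_ne_zero (hP ▸ hp.out.ne_zero)
  have : IsCyclic P := isCyclic_of_prime_card hP
  obtain ⟨⟨x, hxP⟩, hx⟩ := IsCyclic.exists_generator (α := P)
  have hpow (h : G) (hh : h ∈ P) : ∃ n : ℕ, x ^ n = h := by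
    obtain ⟨n, hn⟩ := mem_powers_iff_mem_zpowers.mpr (hx ⟨h, hh⟩)
    exact ⟨n, congrArg Subtype.val hn⟩
  have hxp : x ^ p = 1 := by
    simpa [hP] using congrArg Subtype.val (pow_card_eq_one' (x := (⟨x, hxP⟩ : P)))
  have hact (μ : k) (n : ℕ) (v : V) (hv : v ∈ (Module.End.eigenspace (ρ x) μ)) :
      ρ (x ^ n) v = μ ^ n • v := by
    rw [Module.End.mem_eigenspace_iff] at hv
    induction n with
    | zero => simp
    | succ n ih =>
      rw [pow_succ, map_mul, Module.End.mul_apply, hv, map_smul, ih, smul_smul, pow_succ']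
  have hle (μ : k) : Module.finrank k (Module.End.eigenspace (ρ x) μ) * Module.finrank k V ≤
      P.index := by
    refine ρ.finrank_mul_finrank_le_index P _ fun h hh => ?_
    obtain ⟨n, rfl⟩ := hpow h hh
    exact ⟨μ ^ n, hact μ n⟩
  let W : Subrepresentation ρ :=
    { toSubmodule := Module.End.eigenspace (ρ x) 1
      apply_mem_toSubmodule := fun g v hv => by
        obtain ⟨n, hn⟩ := hpow (g⁻¹ * x * g) (by
          simpa using ‹P.Normal›.conj_mem x hxP g⁻¹)
        have h1 := hact 1 n v hv
        rw [hn] at h1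
        rw [Module.End.mem_eigenspace_iff, one_smul, ← Module.End.mul_apply, ← map_mul,
          show x * g = g * (g⁻¹ * x * g) by group, map_mul, Module.End.mul_apply, h1]
        simp }
  have hbot : Module.End.eigenspace (ρ x) 1 = ⊥ := by
    obtain h | h := eq_bot_or_eq_top W
    · exact congrArg Subrepresentation.toSubmodule h
    · have h1 := hle 1
      rw [show Module.End.eigenspace (ρ x) 1 = ⊤ from congrArg Subrepresentation.toSubmodule h,
        finrank_top, ← sq] at h1
      exact absurd h1 hV.not_ge
  have hss : Module.End.IsSemisimple (ρ x) := by
    refine Module.End.isSemisimple_of_squarefree_aeval_eq_zero (p := Polynomial.X ^ p - 1)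
      (Polynomial.X_pow_sub_one_separable_iff.mpr
        (Nat.cast_ne_zero.mpr hp.out.ne_zero)).squarefree ?_
    rw [map_sub, map_pow, Polynomial.aeval_X, map_one, ← map_pow, hxp, map_one, sub_self]
  set s := (Polynomial.nthRootsFinset p (1 : k)).erase 1
  have hscard : s.card ≤ p - 1 := by
    rw [Finset.card_erase_of_mem (by simp [Polynomial.mem_nthRootsFinset hp.out.pos])]
    exact Nat.sub_le_sub_right
      ((Multiset.toFinset_card_le _).trans (Polynomial.card_nthRoots p 1)) 1
  have hsup : (⨆ μ ∈ s, Module.End.eigenspace (ρ x) μ) = ⊤ := by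
    refine top_le_iff.mp (hss.iSup_eigenspace_eq_top.ge.trans (iSup_le fun μ => ?_))
    by_cases hμ : Module.End.eigenspace (ρ x) μ = ⊥
    · simp [hμ]
    · obtain ⟨v, hv, hv0⟩ := Submodule.exists_mem_ne_zero_of_ne_bot hμ
      have hroot : μ ^ p = 1 := by
        have h1 := hact μ p v hv
        rw [hxp, map_one, Module.End.one_apply] at h1
        exact smul_left_injective k hv0 (by simpa using h1.symm)
      exact le_iSup₂_of_le μ (Finset.mem_erase.mpr
        ⟨fun h => hμ (h ▸ hbot), (Polynomial.mem_nthRootsFinset hp.out.pos _).mpr hroot⟩) le_rfl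
  have hpos : 0 < Module.finrank k V := Nat.pos_of_ne_zero fun h => by simp [h] at hV
  calc Module.finrank k V = Module.finrank k (⨆ μ ∈ s, Module.End.eigenspace (ρ x) μ :
        Submodule k V) := by rw [hsup, finrank_top]
    _ ≤ ∑ μ ∈ s, Module.finrank k (Module.End.eigenspace (ρ x) μ) :=
        Submodule.finrank_biSup_le _ _
    _ ≤ s.card * (P.index / Module.finrank k V) := by
        rw [← smul_eq_mul]
        exact Finset.sum_le_card_nsmul _ _ _ fun μ _ =>
          (Nat.le_div_iff_mul_le hpos).mpr (hle μ)
    _ ≤ (p - 1) * (P.index / Module.finrank k V) := by gcongr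

end Representation

theorem FDRep.isIrreducible_of_simple {k : Type*} {G : Type*} [Field k] [Group G]
    (V : FDRep k G) [Simple V] : Representation.IsIrreducible V.ρ := by
  have hnt : Nontrivial V := by
    by_contra h
    rw [not_nontrivial_iff_subsingleton] at h
    refine id_nonzero V ?_
    ext v
    exact Subsingleton.elim _ _
  refine { exists_pair_ne := ⟨⊥, ⊤, fun h => ?_⟩, eq_bot_or_eq_top := fun W => ?_ }
  · exact bot_ne_top (α := Submodule k V) (congrArg Subrepresentation.toSubmodule h)
  let f : FDRep.of W.toRepresentation ⟶ V :=
    { hom := FGModuleCat.ofHom W.toSubmodule.subtype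
      comm := fun g => by ext; rfl }
  have hmono : Mono f := by
    refine (CategoryTheory.forget (FDRep k G)).mono_of_mono_map ?_
    exact (mono_iff_injective _).mpr W.toSubmodule.injective_subtype
  by_cases hf : f = 0
  · left
    refine Subrepresentation.toSubmodule_injective ((Submodule.eq_bot_iff _).mpr fun v hv => ?_)
    exact congrArg (fun φ : FDRep.of W.toRepresentation ⟶ V => φ.hom.hom.hom ⟨v, hv⟩) hf
  · right
    have := isIso_of_mono_of_nonzero hf
    refine Subrepresentation.toSubmodule_injective (eq_top_iff.mpr fun v _ => ?_)
    let e := FDRep.isoToLinearEquiv (asIso f)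
    have : ((e.symm v : W.toSubmodule) : V) = v := e.apply_symm_apply v
    exact this ▸ (e.symm v : W.toSubmodule).2

/-- There is no finite group of order 3520 with an irreducible complex character
of degree 55. -/
theorem no_group_order_3520_degree_55 (G : Type) [Group G] [Finite G]
    (hcard : Nat.card G = 3520)
    (χ : G → ℂ) (hχ : IsIrrChar G χ) (hdeg : χ 1 = (55 : ℂ)) :
    False := by
  obtain ⟨V, hV, rfl⟩ := hχ
  have hfin : Module.finrank ℂ V = 55 := by
    rw [FDRep.char_one] at hdeg
    exact_mod_cast hdeg
  have := V.isIrreducible_of_simple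
  have : Fact (Nat.Prime 11) := ⟨by norm_num⟩
  obtain ⟨P⟩ : Nonempty (Sylow 11 G) := inferInstance
  obtain ⟨hnormal, hP⟩ := Sylow.normal_of_card_eq_3520 hcard P
  have hindex : P.index = 320 := by
    have := P.card_mul_index
    rw [hP, hcard] at this
    omega
  have := Representation.finrank_le_of_normal_of_card_prime V.ρ P hP
    (by rw [hindex, hfin]; norm_num)
  rw [hindex, hfin] at this
  omega
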